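/- arXiv:2503.14285 — 2 statements merged into one kernel-verified Lean document; each statement's English description precedes it below -/
import Mathlib

section
/- Let 𝔽_q have odd characteristic and let 𝙼 be a matrix over 𝔽_q with rows indexed by a finite set V, columns indexed by a finite set E, and rank equal to |V|. For each α ∈ (𝔽_q^*)^E, let W*(α) ⊆ V be any subset of minimum cardinality among subsets W with s'(𝙼/W;α) ≠ 0, and set r*(α) = |V| − |W*(α)|. Then, as an identity in ℚ, ∑_{S⊆E} (−1)^{|S|} q^{|E∖S| − rank(𝙼_{E∖S})} = ∑_{α ∈ (𝔽_q^*)^E} g(q, r*(α)) · η( s'(𝙼/W*(α); α) ), where 𝙼_T denotes the submatrix of 𝙼 on the columns in T and the left-hand side equals χ_{M✶}(q) for the column matroid M of 𝙼. Moreover, each summand on the right is independent of the choice of W*(α). -/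
/-!
STATEMENT 2: α-representation for the characteristic polynomial of the dual of
the column matroid of a matrix over `𝔽_q` (Theorem 4 of the paper), together
with the independence of each summand of the choice of `W*(α)`.
-/

namespace AlphaRepr

variable {V E F : Type} [Fintype V] [Fintype E] [DecidableEq V] [DecidableEq E] [Field F]

/-- The determinant of the square submatrix of `Mx` on rows `R` and columns `C`
(enumerating `R` and `C` via `Finset.equivFin`); `0` when `|C| ≠ |R|`.
Its square `sdet² = det(Mx|_B)²` is independent of the enumeration. -/
noncomputable def sdet (Mx : Matrix V E F) (R : Finset V) (C : Finset E) : F :=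
  if h : C.card = R.card then
    Matrix.det (Matrix.of fun i j : Fin R.card =>
      Mx (↑(R.equivFin.symm i)) (↑(C.equivFin.symm (Fin.cast h.symm j))))
  else 0

/-- `s'(𝙼/W;α) = ∑_{B, |B| = |V∖W|} det((𝙼/W)|_B)² ∏_{e∈B} α_e`, where `𝙼/W` is
`𝙼` with the rows in `W` deleted.  (Summands with singular `(𝙼/W)|_B` vanish.) -/
noncomputable def sprime (Mx : Matrix V E F) (W : Finset V) (α : E → F) : F :=
  ∑ B ∈ Finset.univ.filter (fun B : Finset E => B.card = Wᶜ.card),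
    (sdet Mx Wᶜ B) ^ 2 * ∏ e ∈ B, α e

/-- The rank of the set of columns of `Mx` indexed by `T`. -/
noncomputable def colRank (Mx : Matrix V E F) (T : Finset E) : ℕ :=
  (Mx.submatrix id (fun j : T => (j : E))).rank

/-- `g(q,m) = η(−1)^{m/2} q^{−m/2}` for even `m`, `g(q,m) = 0` for odd `m`. -/
noncomputable def g (F : Type) [Field F] [Fintype F] [DecidableEq F] (m : ℕ) : ℚ :=
  if Even m then
    ((quadraticChar F (-1) : ℤ) : ℚ) ^ (m / 2) * ((Fintype.card F : ℚ))⁻¹ ^ (m / 2)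
  else 0

section

open Finset Matrix

theorem exists_congr_diagonal {m F : Type*} [Fintype m] [DecidableEq m] [Field F]
    (h2 : (2 : F) ≠ 0) (A : Matrix m m F) (hA : A.IsSymm) :
    ∃ (P : Matrix m m F) (w : m → F), IsUnit P.det ∧ Pᵀ * A * P = diagonal w := by
  have : Invertible (2 : F) := invertibleOfNonzero h2
  set B : LinearMap.BilinForm F (m → F) := Matrix.toLinearMap₂' F A with hB
  have hBs : LinearMap.IsSymm B := ⟨fun x y => by
    simp only [hB, Matrix.toLinearMap₂'_apply', RingHom.id_apply]
    rw [dotProduct_mulVec, ← mulVec_transpose, hA.eq, dotProduct_comm]⟩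
  obtain ⟨v, hv⟩ := LinearMap.BilinForm.exists_orthogonal_basis hBs
  set b : Module.Basis m F (m → F) :=
    v.reindex (Fintype.equivOfCardEq (by simp)) with hb
  have hbo : ∀ i j, i ≠ j → B (b i) (b j) = 0 := fun i j hij => by
    rw [hb, Module.Basis.reindex_apply, Module.Basis.reindex_apply]
    exact LinearMap.isOrthoᵢ_def.mp hv _ _ (by simpa using hij)
  refine ⟨(Pi.basisFun F m).toMatrix b, fun i => B (b i) (b i), ?_, ?_⟩
  · exact (Pi.basisFun F m).isUnit_det b
  · have key : ∀ i j, (((Pi.basisFun F m).toMatrix b)ᵀ * A * (Pi.basisFun F m).toMatrix b) i j =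
        B (b i) (b j) := fun i j => by
      rw [hB, Matrix.toLinearMap₂'_apply', Matrix.mul_assoc]
      simp only [Matrix.mul_apply, dotProduct, mulVec, transpose_apply,
        Module.Basis.toMatrix_apply, Pi.basisFun_repr]
    ext i j
    rw [key, diagonal_apply]
    split_ifs with hij
    · rw [hij]
    · exact hbo i j hij

theorem schur_complement_eq_zero {m n F : Type*} [Field F] [Fintype m] [DecidableEq m]
    (A : Matrix m m F) (B : Matrix m n F) (D : Matrix n n F) (hA : A.IsSymm) (hD : D.IsSymm)
    (hdet : A.det ≠ 0)
    (hmin : ∀ (k : ℕ) (f : Fin (k + 1) → n), Function.Injective f →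
      ((fromBlocks A B Bᵀ D).submatrix (Sum.map id f) (Sum.map id f)).det = 0) :
    D - Bᵀ * A⁻¹ * B = 0 := by
  set S := D - Bᵀ * A⁻¹ * B with hS
  have hSs : S.IsSymm := by
    rw [Matrix.IsSymm, hS, transpose_sub, hD.eq, transpose_mul, transpose_mul, transpose_transpose,
      transpose_nonsing_inv, hA.eq, Matrix.mul_assoc]
  have : Invertible A := Matrix.invertibleOfIsUnitDet A (isUnit_iff_ne_zero.mpr hdet)
  have key : ∀ (k : ℕ) (f : Fin (k + 1) → n), Function.Injective f →
      (S.submatrix f f).det = 0 := fun k f hf => by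
    have h := hmin k f hf
    have hsub : (fromBlocks A B Bᵀ D).submatrix (Sum.map id f) (Sum.map id f) =
        fromBlocks A (B.submatrix id f) (Bᵀ.submatrix f id) (D.submatrix f f) := by
      ext (i | i) (j | j) <;> rfl
    rw [hsub, det_fromBlocks₁₁, mul_eq_zero, or_iff_right hdet, invOf_eq_nonsing_inv] at h
    rw [← h]
    rfl
  ext i j
  have hdiag : ∀ i, S i i = 0 := fun i => by
    simpa using key 0 (fun _ => i) fun a b _ => by fin_cases a; fin_cases b; rfl
  rcases eq_or_ne i j with rfl | hij
  · exact hdiag i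
  · have h := key 1 ![i, j] (by
      intro a b
      fin_cases a <;> fin_cases b <;> simp [hij, hij.symm])
    rw [det_fin_two] at h
    simpa [hdiag, hSs.apply i j] using h

theorem addChar_map_sum {ι F K : Type*} [AddCommMonoid F] [CommMonoid K]
    (ψ : AddChar F K) (s : Finset ι) (f : ι → F) :
    ψ (∑ i ∈ s, f i) = ∏ i ∈ s, ψ (f i) := by
  classical
  induction s using Finset.induction_on with
  | empty => simp
  | insert a s ha ih => rw [sum_insert ha, prod_insert ha, AddChar.map_add_eq_mul, ih]

theorem sum_addChar_congr {m F K : Type*} [Field F] [Fintype F] [Field K] [Fintype m]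
    [DecidableEq m] (ψ : AddChar F K)
    (A Q : Matrix m m F) (hQ : IsUnit Q.det) :
    ∑ u : m → F, ψ (u ⬝ᵥ (Qᵀ * A * Q) *ᵥ u) = ∑ u : m → F, ψ (u ⬝ᵥ A *ᵥ u) := by
  refine Fintype.sum_bijective (Q *ᵥ ·)
    ⟨mulVec_injective_iff_isUnit.mpr ((Matrix.isUnit_iff_isUnit_det Q).mpr hQ),
      mulVec_surjective_iff_isUnit.mpr ((Matrix.isUnit_iff_isUnit_det Q).mpr hQ)⟩ _ _
    fun u => ?_
  rw [Matrix.mul_assoc, ← mulVec_mulVec, ← mulVec_mulVec, dotProduct_mulVec, vecMul_transpose]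

section QuadraticSums

variable {F K : Type*} [Field F] [Fintype F] [DecidableEq F] [Field K]

/-- The quadratic character with values in a field `K`. -/
noncomputable abbrev eta (F K : Type*) [Field F] [Fintype F] [DecidableEq F] [Field K] :
    MulChar F K :=
  (quadraticChar F).ringHomComp (Int.castRingHom K)

theorem sum_sq_eq (hF : ringChar F ≠ 2) (f : F → K) :
    ∑ x, f (x ^ 2) = ∑ y, (1 + eta F K y) * f y := by
  rw [← Finset.sum_fiberwise univ fun x : F => x ^ 2]
  refine Finset.sum_congr rfl fun y _ => ?_
  rw [Finset.sum_congr rfl fun x hx => by rw [(mem_filter.mp hx).2], sum_const, nsmul_eq_mul]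
  congr 1
  have h := congrArg (Int.cast : ℤ → K) (quadraticChar_card_sqrts hF y)
  rw [Int.cast_natCast, Int.cast_add, Int.cast_one, add_comm] at h
  rw [MulChar.ringHomComp_apply, eq_intCast, ← h]
  congr 2
  ext x
  simp

theorem sum_addChar_mul_sq (hF : ringChar F ≠ 2) {ψ : AddChar F K} (hψ : ψ.IsPrimitive)
    {w : F} (hw : w ≠ 0) :
    ∑ x, ψ (w * x ^ 2) = eta F K w * gaussSum (eta F K) ψ := by
  rw [sum_sq_eq hF fun y => ψ (w * y)]
  simp only [add_mul, one_mul, sum_add_distrib]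
  have h0 : ∑ y, ψ (w * y) = 0 := by
    have := AddChar.sum_mulShift w hψ
    simpa [hw, mul_comm] using this
  have hsq : eta F K w * eta F K w = 1 := by
    rw [← map_mul, ← sq, MulChar.ringHomComp_apply, quadraticChar_sq_one' hw, map_one]
  have hs := gaussSum_mulShift (eta F K) ψ (Units.mk0 w hw)
  rw [h0, zero_add, ← hs, Units.val_mk0, ← mul_assoc, hsq, one_mul]
  rfl

theorem sum_addChar_of_det_ne_zero {m : Type*} [Fintype m] [DecidableEq m]
    (hF : ringChar F ≠ 2) {ψ : AddChar F K} (hψ : ψ.IsPrimitive)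
    (A : Matrix m m F) (hA : A.IsSymm) (hdet : A.det ≠ 0) :
    ∑ u : m → F, ψ (u ⬝ᵥ A *ᵥ u) =
      eta F K A.det * gaussSum (eta F K) ψ ^ Fintype.card m := by
  obtain ⟨P, w, hP, hw⟩ := exists_congr_diagonal (Ring.two_ne_zero hF) A hA
  have hprod : P.det ^ 2 * A.det = ∏ i, w i := by
    rw [← det_diagonal, ← hw, det_mul, det_mul, det_transpose]
    ring
  have hw0 : ∀ i, w i ≠ 0 := fun i => by
    have : ∏ i, w i ≠ 0 := hprod ▸ mul_ne_zero (pow_ne_zero _ hP.ne_zero) hdet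
    exact Finset.prod_ne_zero_iff.mp this i (mem_univ i)
  have heta : eta F K A.det = ∏ i, eta F K (w i) := by
    rw [← map_prod, ← hprod, map_mul, MulChar.ringHomComp_apply (a := P.det ^ 2),
      quadraticChar_sq_one' hP.ne_zero, map_one, one_mul]
  rw [← sum_addChar_congr ψ A P hP, hw, heta, ← Finset.card_univ, ← Finset.prod_const,
    ← Finset.prod_mul_distrib]
  simp_rw [← sum_addChar_mul_sq hF hψ (hw0 _)]
  rw [Finset.prod_univ_sum, Fintype.piFinset_univ]
  refine Finset.sum_congr rfl fun u _ => ?_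
  rw [← addChar_map_sum]
  congr 1
  simp only [dotProduct, mulVec_diagonal]
  exact Finset.sum_congr rfl fun i _ => by ring

theorem sum_addChar_fromBlocks {m n : Type*} [Fintype m] [DecidableEq m] [Fintype n]
    [DecidableEq n] (hF : ringChar F ≠ 2) {ψ : AddChar F K} (hψ : ψ.IsPrimitive)
    (A : Matrix m m F) (B : Matrix m n F) (D : Matrix n n F) (hA : A.IsSymm) (hD : D.IsSymm)
    (hdet : A.det ≠ 0)
    (hmin : ∀ (k : ℕ) (f : Fin (k + 1) → n), Function.Injective f →
      ((fromBlocks A B Bᵀ D).submatrix (Sum.map id f) (Sum.map id f)).det = 0) :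
    ∑ u : m ⊕ n → F, ψ (u ⬝ᵥ (fromBlocks A B Bᵀ D) *ᵥ u) =
      (Fintype.card F : K) ^ Fintype.card n *
        (eta F K A.det * gaussSum (eta F K) ψ ^ Fintype.card m) := by
  have : Invertible A := Matrix.invertibleOfIsUnitDet A (isUnit_iff_ne_zero.mpr hdet)
  have hdec : fromBlocks A B Bᵀ D =
      (fromBlocks 1 (⅟A * B) 0 1)ᵀ * fromBlocks A 0 0 0 * fromBlocks 1 (⅟A * B) 0 1 := by
    have h := fromBlocks_eq_of_invertible₁₁ A B Bᵀ D
    rw [invOf_eq_nonsing_inv, schur_complement_eq_zero A B D hA hD hdet hmin] at h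
    rw [h, fromBlocks_transpose, invOf_eq_nonsing_inv, transpose_mul, transpose_nonsing_inv, hA.eq]
    simp
  rw [hdec, sum_addChar_congr, ← sum_addChar_of_det_ne_zero hF hψ A hA hdet,
    Fintype.sum_equiv (Equiv.sumArrowEquivProdArrow m n F) _
      (fun p => ψ (p.1 ⬝ᵥ A *ᵥ p.1)) ?_, Fintype.sum_prod_type_right]
  · simp
  · intro u
    congr 1
    rw [fromBlocks_mulVec]
    simp [dotProduct]
    rfl
  · simp

theorem sum_addChar_of_maximal_minor {V : Type*} [Fintype V] [DecidableEq V]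
    (hF : ringChar F ≠ 2) {ψ : AddChar F K} (hψ : ψ.IsPrimitive)
    (L : Matrix V V F) (hL : L.IsSymm) (R : Finset V)
    (hdet : (L.submatrix (Subtype.val : {v // v ∈ R} → V) Subtype.val).det ≠ 0)
    (hmax : ∀ T : Finset V, R.card < T.card →
      (L.submatrix (Subtype.val : {v // v ∈ T} → V) Subtype.val).det = 0) :
    ∑ u : V → F, ψ (u ⬝ᵥ L *ᵥ u) =
      (Fintype.card F : K) ^ Rᶜ.card *
        (eta F K (L.submatrix (Subtype.val : {v // v ∈ R} → V) Subtype.val).det *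
          gaussSum (eta F K) ψ ^ R.card) := by
  set e : {v // v ∈ R} ⊕ {v // v ∉ R} ≃ V := Equiv.sumCompl (· ∈ R) with he
  set A := L.submatrix (Subtype.val : {v // v ∈ R} → V) Subtype.val
  set B := L.submatrix (Subtype.val : {v // v ∈ R} → V) (Subtype.val : {v // v ∉ R} → V)
  set D := L.submatrix (Subtype.val : {v // v ∉ R} → V) Subtype.val
  have hblocks : L.submatrix e e = fromBlocks A B Bᵀ D := by
    ext (i | i) (j | j)
    · rfl
    · rfl
    · exact hL.apply _ _
    · rfl
  have h := sum_addChar_fromBlocks hF hψ A B D (hL.submatrix _) (hL.submatrix _) hdet ?_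
  · rw [Fintype.card_coe, Fintype.card_subtype_compl, Fintype.card_coe, ← card_compl] at h
    rw [← h, ← hblocks]
    refine Fintype.sum_equiv (e.symm.arrowCongr (Equiv.refl F)) _ _ fun u => ?_
    congr 1
    have : (e.symm.arrowCongr (Equiv.refl F)) u = u ∘ e := rfl
    rw [this, submatrix_mulVec_equiv, Function.comp_assoc, Equiv.self_comp_symm,
      Function.comp_id, comp_equiv_dotProduct_comp_equiv]
  · intro k f hf
    rw [← hblocks, submatrix_submatrix]
    have hinj : Function.Injective (e ∘ Sum.map id f) :=
      e.injective.comp (Function.injective_id.sumMap hf)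
    set T := univ.map ⟨_, hinj⟩ with hT
    let e' : {v // v ∈ R} ⊕ Fin (k + 1) ≃ {v // v ∈ T} :=
      (Equiv.ofInjective _ hinj).trans (Equiv.subtypeEquivRight fun v => by simp [hT])
    rw [← hmax T (by simp [hT]), ← det_submatrix_equiv_self e']
    rfl

end QuadraticSums

theorem det_mul_eq_sum_fun {m E F : Type*} [Fintype m] [DecidableEq m] [Fintype E] [CommRing F]
    (A : Matrix m E F) (B : Matrix E m F) :
    (A * B).det = ∑ f : m → E, (∏ i, A i (f i)) * (B.submatrix f id).det := by
  classical
  have h : A * B = fun i => ∑ e, A i e • B e := by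
    ext i j
    simp [Matrix.mul_apply, Finset.sum_apply]
  calc (A * B).det = detRowAlternating.toMultilinearMap (fun i => ∑ e, A i e • B e) := by
        rw [h]; rfl
    _ = _ := by
        rw [MultilinearMap.map_sum]
        refine Finset.sum_congr rfl fun f _ => ?_
        rw [MultilinearMap.map_smul_univ, smul_eq_mul]
        rfl

/-- The Cauchy–Binet formula. -/
theorem det_mul_cauchyBinet {E F : Type*} {r : ℕ} [Fintype E] [DecidableEq E] [CommRing F]
    (A : Matrix (Fin r) E F) (B : Matrix E (Fin r) F) :
    (A * B).det = ∑ S : Finset E, if h : S.card = r then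
      (A.submatrix id fun j => (S.equivFin.symm (Fin.cast h.symm j) : E)).det *
        (B.submatrix (fun j => (S.equivFin.symm (Fin.cast h.symm j) : E)) id).det else 0 := by
  classical
  rw [det_mul_eq_sum_fun, ← Finset.sum_fiberwise univ fun f : Fin r → E => univ.image f]
  refine Finset.sum_congr rfl fun S _ => ?_
  split_ifs with h
  · set e : Fin r ≃ S := (finCongr h.symm).trans S.equivFin.symm with he
    have hterm : ∀ σ : Equiv.Perm (Fin r),
        (B.submatrix (fun i => (e (σ i) : E)) id).det =
          Equiv.Perm.sign σ * (B.submatrix (fun i => (e i : E)) id).det := fun σ =>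
      Matrix.det_permute σ (B.submatrix (fun i => (e i : E)) id)
    change _ = (A.submatrix id fun j => (e j : E)).det *
      (B.submatrix (fun j => (e j : E)) id).det
    rw [← det_transpose (A.submatrix id _), det_apply, Finset.sum_mul]
    symm
    refine Finset.sum_bij (fun σ _ i => (e (σ i) : E)) ?_ ?_ ?_ ?_
    · intro σ _
      simp only [mem_filter, mem_univ, true_and]
      ext x
      simp only [mem_image, mem_univ, true_and]
      constructor
      · rintro ⟨i, rfl⟩
        exact (e (σ i)).2
      · intro hx
        exact ⟨σ.symm (e.symm ⟨x, hx⟩), by simp⟩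
    · intro σ _ τ _ hστ
      ext1 i
      exact e.injective (Subtype.ext (congrFun hστ i))
    · intro f hf
      have hf' : univ.image f = S := by simpa using hf
      have hmem : ∀ i, f i ∈ S := fun i => hf' ▸ mem_image_of_mem f (mem_univ i)
      have hinj : Function.Injective f := by
        have := Finset.injOn_of_card_image_eq (s := univ) (f := f) (by rw [hf', h]; simp)
        simpa using this
      refine ⟨Equiv.ofBijective (fun i => e.symm ⟨f i, hmem i⟩)
        (Finite.injective_iff_bijective.mp fun i j hij => hinj ?_), mem_univ _, ?_⟩
      · simpa using hij
      · ext i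
        simp
    · intro σ _
      rw [hterm]
      simp only [transpose_apply, submatrix_apply, id, Units.smul_def, zsmul_eq_mul]
      ring
  · refine Finset.sum_eq_zero fun f hf => ?_
    have hf' : univ.image f = S := by simpa using hf
    have hninj : ¬ Function.Injective f := fun hinj => h <| by
      rw [← hf', card_image_of_injective _ hinj, card_univ, Fintype.card_fin]
    obtain ⟨i, j, hij, hne⟩ := Function.not_injective_iff.mp hninj
    rw [det_zero_of_row_eq hne, mul_zero]
    ext k
    simp [hij]

theorem sprime_eq_det (Mx : Matrix V E F) (W : Finset V) (α : E → F) :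
    sprime Mx W α = ((Mx * diagonal α * Mxᵀ).submatrix
      (Subtype.val : {v // v ∈ Wᶜ} → V) Subtype.val).det := by
  set e := (Wᶜ).equivFin.symm with he
  set A : Matrix (Fin Wᶜ.card) E F := Mx.submatrix (fun i => (e i : V)) id with hA
  have hsub : ((Mx * diagonal α * Mxᵀ).submatrix
      (Subtype.val : {v // v ∈ Wᶜ} → V) Subtype.val).submatrix e e =
        A * (diagonal α * Aᵀ) := by
    rw [← Matrix.mul_assoc]
    ext i j
    simp [hA, Matrix.mul_apply, diagonal_apply]
  rw [← det_submatrix_equiv_self e, hsub, det_mul_cauchyBinet, sprime, sum_filter]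
  refine Finset.sum_congr rfl fun B _ => ?_
  split_ifs with h
  · set b : Fin Wᶜ.card → E := fun j => (B.equivFin.symm (Fin.cast h.symm j) : E) with hb
    have hs : sdet Mx Wᶜ B = (A.submatrix id b).det := by
      rw [sdet, dif_pos h]
      rfl
    have hd : (diagonal α * Aᵀ).submatrix b id =
        diagonal (fun j => α (b j)) * (A.submatrix id b)ᵀ := by
      ext i j
      simp
    have hp : ∏ j, α (b j) = ∏ x ∈ B, α x := by
      rw [← Finset.prod_coe_sort B α]
      exact Fintype.prod_equiv ((finCongr h.symm).trans B.equivFin.symm) _ _ fun _ => rfl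
    rw [hs, hd, det_mul, det_diagonal, det_transpose, hp]
    ring
  · rfl

theorem card_filter_mulVec_eq_zero {V E F : Type} [Fintype V] [Fintype E] [DecidableEq E]
    [Field F] [Fintype F] [DecidableEq F] (N : Matrix V E F) :
    #{x : E → F | N *ᵥ x = 0} = Fintype.card F ^ (Fintype.card E - N.rank) := by
  have h : Module.finrank F (LinearMap.ker N.mulVecLin) = Fintype.card E - N.rank := by
    have := N.mulVecLin.finrank_range_add_finrank_ker
    rw [Module.finrank_fintype_fun_eq_card] at this
    rw [Matrix.rank]
    omega
  rw [← h, ← Nat.card_eq_fintype_card (α := F), ← Module.natCard_eq_pow_finrank,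
    ← Fintype.card_subtype, ← Nat.card_eq_fintype_card]
  rfl

theorem card_filter_vanishing {V E F : Type} [Fintype V] [Fintype E] [DecidableEq E] [Field F]
    [Fintype F] [DecidableEq F] (Mx : Matrix V E F) (S : Finset E) :
    #{x : E → F | Mx *ᵥ x = 0 ∧ ∀ e ∈ S, x e = 0} =
      Fintype.card F ^ (Sᶜ.card - colRank Mx Sᶜ) := by
  have hres : ∀ y : E → F, (∀ e ∈ S, y e = 0) →
      Mx.submatrix id (fun j : {e // e ∈ Sᶜ} => (j : E)) *ᵥ (fun j => y j) = Mx *ᵥ y := by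
    intro y hy
    ext v
    simp only [mulVec, dotProduct, submatrix_apply, id]
    rw [Finset.sum_coe_sort Sᶜ fun e => Mx v e * y e]
    refine Finset.sum_subset (subset_univ _) fun e _ he => ?_
    rw [hy e (by simpa using he), mul_zero]
  rw [colRank, ← Fintype.card_coe Sᶜ, ← card_filter_mulVec_eq_zero]
  refine Finset.card_nbij' (fun y j => y j)
    (fun x e => if h : e ∈ Sᶜ then x ⟨e, h⟩ else 0) ?_ ?_ ?_ ?_
  · intro y hy
    simp only [coe_filter, mem_univ, true_and, Set.mem_ofPred_eq] at hy ⊢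
    rw [hres y hy.2, hy.1]
  · intro x hx
    simp only [coe_filter, mem_univ, true_and, Set.mem_ofPred_eq] at hx ⊢
    have h0 : ∀ e ∈ S, (if h : e ∈ Sᶜ then x ⟨e, h⟩ else 0) = 0 := fun e he => by
      rw [dif_neg (by simpa using he)]
    refine ⟨?_, h0⟩
    rw [← hres _ h0, ← hx]
    congr 1
    ext j
    rw [dif_pos j.2]
  · intro y hy
    simp only [coe_filter, mem_univ, true_and, Set.mem_ofPred_eq] at hy
    ext e
    by_cases he : e ∈ S
    · simp [he, hy.2 e he]
    · simp [he]
  · intro x _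
    ext j
    simp only [dif_pos j.2]

theorem sum_neg_one_pow_eq_card {V E F : Type} [Fintype V] [Fintype E] [DecidableEq E]
    [Field F] [Fintype F] [DecidableEq F] (Mx : Matrix V E F) :
    (∑ S : Finset E,
        (-1 : ℚ) ^ S.card * (Fintype.card F : ℚ) ^ (Sᶜ.card - colRank Mx Sᶜ)) =
      #{x : E → F | Mx *ᵥ x = 0 ∧ ∀ e, x e ≠ 0} := by
  have h : ∀ S : Finset E,
      (-1 : ℚ) ^ S.card * (Fintype.card F : ℚ) ^ (Sᶜ.card - colRank Mx Sᶜ) =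
        ∑ x : E → F with Mx *ᵥ x = 0,
          if S ∈ ({e | x e = 0} : Finset E).powerset then (-1 : ℚ) ^ S.card else 0 := by
    intro S
    rw [← Nat.cast_pow, ← card_filter_vanishing, ← sum_filter, filter_filter, sum_const,
      nsmul_eq_mul, mul_comm]
    simp [Finset.subset_iff]
  rw [Finset.sum_congr rfl fun S _ => h S, sum_comm]
  simp_rw [sum_ite_mem, univ_inter]
  have h' : ∀ x : E → F, ∑ S ∈ ({e | x e = 0} : Finset E).powerset, (-1 : ℚ) ^ S.card =
      if ∀ e, x e ≠ 0 then 1 else 0 := by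
    intro x
    have := congrArg (Int.cast : ℤ → ℚ)
      (sum_powerset_neg_one_pow_card (x := ({e | x e = 0} : Finset E)))
    push_cast at this
    rw [this]
    simp [filter_eq_empty_iff]
  simp_rw [h']
  rw [sum_boole, filter_filter]

section CharacterSums

variable [Fintype F] [DecidableEq F] {K : Type} [Field K] {ψ : AddChar F K}

theorem sum_ne_zero_addChar_mul_sq (hψ : ψ.IsPrimitive) (y : F) :
    ∑ a with a ≠ 0, ψ (a * y ^ 2) = ∑ a with a ≠ 0, ψ (a * y) := by
  have h : ∀ z : F, ∑ a with a ≠ 0, ψ (a * z) =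
      (if z = 0 then (Fintype.card F : K) else 0) - 1 := by
    intro z
    have hs := AddChar.sum_mulShift z hψ
    rw [← sum_filter_add_sum_filter_not univ fun a : F => a ≠ 0] at hs
    simp only [ne_eq, not_not, filter_eq', mem_univ, if_true, sum_singleton, zero_mul,
      AddChar.map_zero_eq_one] at hs
    rw [eq_sub_iff_add_eq]
    simpa using hs
  rw [h, h]
  simp

theorem sum_addChar_dotProduct (hψ : ψ.IsPrimitive) (z : V → F) :
    ∑ φ : V → F, ψ (φ ⬝ᵥ z) = if z = 0 then (Fintype.card F : K) ^ Fintype.card V else 0 := by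
  have h : ∑ φ : V → F, ψ (φ ⬝ᵥ z) = ∏ v, ∑ t, ψ (t * z v) := by
    rw [Finset.prod_univ_sum, Fintype.piFinset_univ]
    exact Finset.sum_congr rfl fun φ _ => addChar_map_sum ψ univ _
  rw [h]
  simp_rw [AddChar.sum_mulShift _ hψ]
  split_ifs with hz
  · simp [hz]
  · obtain ⟨v, hv⟩ := Function.ne_iff.mp hz
    exact prod_eq_zero (mem_univ v) (by simp [show z v ≠ 0 from hv])

theorem sum_sum_addChar (hψ : ψ.IsPrimitive) (Mx : Matrix V E F) :
    ∑ α : E → F with ∀ e, α e ≠ 0,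
        ∑ φ : V → F, ψ (φ ⬝ᵥ (Mx * diagonal α * Mxᵀ) *ᵥ φ) =
      (Fintype.card F : K) ^ Fintype.card V * #{x : E → F | Mx *ᵥ x = 0 ∧ ∀ e, x e ≠ 0} := by
  have hpi : ({α | ∀ e, α e ≠ 0} : Finset (E → F)) =
      Fintype.piFinset fun _ => ({a | a ≠ 0} : Finset F) := by
    ext
    simp
  have hquad : ∀ (α : E → F) (φ : V → F), ψ (φ ⬝ᵥ (Mx * diagonal α * Mxᵀ) *ᵥ φ) =
      ∏ e, ψ (α e * (φ ᵥ* Mx) e ^ 2) := by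
    intro α φ
    rw [← addChar_map_sum, ← mulVec_mulVec, ← mulVec_mulVec, dotProduct_mulVec, mulVec_transpose]
    congr 1
    simp only [dotProduct, mulVec_diagonal]
    exact Finset.sum_congr rfl fun e _ => by ring
  have hlin : ∀ (x : E → F) (φ : V → F),
      ∏ e, ψ (x e * (φ ᵥ* Mx) e) = ψ (φ ⬝ᵥ Mx *ᵥ x) := by
    intro x φ
    rw [← addChar_map_sum, dotProduct_mulVec, dotProduct_comm]
    rfl
  have hswap : ∀ φ : V → F,
      ∑ α ∈ Fintype.piFinset fun _ : E => ({a | a ≠ 0} : Finset F),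
          ∏ e, ψ (α e * (φ ᵥ* Mx) e ^ 2) =
        ∑ x ∈ Fintype.piFinset fun _ : E => ({a | a ≠ 0} : Finset F),
          ∏ e, ψ (x e * (φ ᵥ* Mx) e) := by
    intro φ
    rw [← Finset.prod_univ_sum _ fun e a => ψ (a * (φ ᵥ* Mx) e ^ 2),
      ← Finset.prod_univ_sum _ fun e a => ψ (a * (φ ᵥ* Mx) e)]
    exact Finset.prod_congr rfl fun e _ => sum_ne_zero_addChar_mul_sq hψ _
  simp_rw [hquad]
  rw [sum_comm, hpi]
  simp_rw [hswap, hlin]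
  rw [sum_comm]
  simp_rw [sum_addChar_dotProduct hψ]
  rw [← hpi, ← sum_filter, sum_const, nsmul_eq_mul, mul_comm, filter_filter]
  simp_rw [and_comm]

theorem sum_addChar_eq_sprime (hF : ringChar F ≠ 2) (hψ : ψ.IsPrimitive) (Mx : Matrix V E F)
    (α : E → F) (W : Finset V) (hne : sprime Mx W α ≠ 0)
    (hmin : ∀ W' : Finset V, sprime Mx W' α ≠ 0 → W.card ≤ W'.card) :
    ∑ φ : V → F, ψ (φ ⬝ᵥ (Mx * diagonal α * Mxᵀ) *ᵥ φ) =
      (Fintype.card F : K) ^ W.card *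
        (eta F K (sprime Mx W α) * gaussSum (eta F K) ψ ^ Wᶜ.card) := by
  have hL : (Mx * diagonal α * Mxᵀ).IsSymm := by
    simp [Matrix.IsSymm, Matrix.mul_assoc]
  have h := sum_addChar_of_maximal_minor hF hψ _ hL Wᶜ (sprime_eq_det Mx W α ▸ hne) ?_
  · rw [h, ← sprime_eq_det, compl_compl]
  · intro T hT
    have hs := sprime_eq_det Mx Tᶜ α
    rw [compl_compl] at hs
    rw [← hs]
    by_contra hT0
    have h1 := hmin _ hT0
    have h2 := card_compl_add_card W
    have h3 := card_compl_add_card T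
    omega

end CharacterSums

theorem sprime_smul {V E F : Type} [Fintype V] [Fintype E] [DecidableEq V] [Field F]
    (Mx : Matrix V E F) (W : Finset V) (c : F) (α : E → F) :
    sprime Mx W (c • α) = c ^ Wᶜ.card * sprime Mx W α := by
  rw [sprime, sprime, mul_sum]
  refine Finset.sum_congr rfl fun B hB => ?_
  simp only [Pi.smul_apply, smul_eq_mul]
  rw [prod_mul_distrib, prod_const, (mem_filter.mp hB).2]
  ring

section Summands

variable [Fintype F] [DecidableEq F] {K : Type} [Field K] [CharZero K] {ψ : AddChar F K}

theorem eta_ne_one (hF : ringChar F ≠ 2) : eta F K ≠ 1 :=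
  (MulChar.ringHomComp_ne_one_iff Int.cast_injective).mpr (quadraticChar_ne_one hF)

theorem gaussSum_eta_ne_zero (hF : ringChar F ≠ 2) (hψ : ψ.IsPrimitive) :
    gaussSum (eta F K) ψ ≠ 0 :=
  gaussSum_ne_zero_of_nontrivial (Nat.cast_ne_zero.mpr Fintype.card_ne_zero) (eta_ne_one hF) hψ

theorem gaussSum_eta_sq (hF : ringChar F ≠ 2) (hψ : ψ.IsPrimitive) :
    gaussSum (eta F K) ψ ^ 2 = eta F K (-1) * Fintype.card F :=
  gaussSum_sq (eta_ne_one hF) ((quadraticChar_isQuadratic F).comp _) hψ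

theorem quadraticChar_sprime_eq (hF : ringChar F ≠ 2) (hψ : ψ.IsPrimitive) (Mx : Matrix V E F)
    (α : E → F) (W₁ W₂ : Finset V) (h₁ : sprime Mx W₁ α ≠ 0)
    (hmin₁ : ∀ W : Finset V, sprime Mx W α ≠ 0 → W₁.card ≤ W.card) (h₂ : sprime Mx W₂ α ≠ 0)
    (hmin₂ : ∀ W : Finset V, sprime Mx W α ≠ 0 → W₂.card ≤ W.card) :
    quadraticChar F (sprime Mx W₁ α) = quadraticChar F (sprime Mx W₂ α) := by
  have hq : (Fintype.card F : K) ≠ 0 := Nat.cast_ne_zero.mpr Fintype.card_ne_zero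
  have h := sum_addChar_eq_sprime hF hψ Mx α W₁ h₁ hmin₁
  rw [sum_addChar_eq_sprime hF hψ Mx α W₂ h₂ hmin₂, card_compl, card_compl,
    le_antisymm (hmin₁ W₂ h₂) (hmin₂ W₁ h₁)] at h
  have h' := mul_right_cancel₀ (pow_ne_zero _ (gaussSum_eta_ne_zero hF hψ))
    (mul_left_cancel₀ (pow_ne_zero _ hq) h)
  exact (Int.cast_injective h').symm

theorem sum_addChar_eq_g_add (hF : ringChar F ≠ 2) (hψ : ψ.IsPrimitive) (Mx : Matrix V E F)
    (α : E → F) (W : Finset V) (hne : sprime Mx W α ≠ 0)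
    (hmin : ∀ W' : Finset V, sprime Mx W' α ≠ 0 → W.card ≤ W'.card) :
    ∑ φ : V → F, ψ (φ ⬝ᵥ (Mx * diagonal α * Mxᵀ) *ᵥ φ) =
      (Fintype.card F : K) ^ Fintype.card V *
          ((g F (Fintype.card V - W.card) *
            ((quadraticChar F (sprime Mx W α) : ℤ) : ℚ) : ℚ) : K) +
        if Odd Wᶜ.card then ∑ φ : V → F, ψ (φ ⬝ᵥ (Mx * diagonal α * Mxᵀ) *ᵥ φ) else 0 := by
  have hq : (Fintype.card F : K) ≠ 0 := Nat.cast_ne_zero.mpr Fintype.card_ne_zero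
  rw [← card_compl, g]
  rcases Nat.even_or_odd Wᶜ.card with he | ho
  · rw [if_pos he, if_neg (Nat.not_odd_iff_even.mpr he), add_zero,
      sum_addChar_eq_sprime hF hψ Mx α W hne hmin]
    obtain ⟨k, hk⟩ := he.exists_two_nsmul
    rw [smul_eq_mul] at hk
    have hV : Fintype.card V = W.card + k + k := by
      have := card_compl_add_card W
      omega
    rw [hk, pow_mul, gaussSum_eta_sq hF hψ, hV, Nat.mul_div_cancel_left k two_pos,
      MulChar.ringHomComp_apply, MulChar.ringHomComp_apply]
    push_cast
    rw [eq_intCast, eq_intCast, pow_add, pow_add, mul_pow, inv_pow]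
    field_simp
  · rw [if_neg (Nat.not_even_iff_odd.mpr ho), if_pos ho]
    simp

theorem sum_odd_eq_zero (hF : ringChar F ≠ 2) (hψ : ψ.IsPrimitive) (Mx : Matrix V E F)
    (Wstar : (E → F) → Finset V)
    (hW_ne : ∀ α : E → F, (∀ e, α e ≠ 0) → sprime Mx (Wstar α) α ≠ 0)
    (hW_min : ∀ α : E → F, (∀ e, α e ≠ 0) →
      ∀ W : Finset V, sprime Mx W α ≠ 0 → (Wstar α).card ≤ W.card) :
    ∑ α : E → F with ∀ e, α e ≠ 0, (if Odd (Wstar α)ᶜ.card then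
      ∑ φ : V → F, ψ (φ ⬝ᵥ (Mx * diagonal α * Mxᵀ) *ᵥ φ) else 0) = 0 := by
  obtain ⟨c, hc⟩ := quadraticChar_exists_neg_one hF
  have hc0 : c ≠ 0 := by
    rintro rfl
    simp at hc
  have heta : eta F K c = -1 := by simp [MulChar.ringHomComp_apply, hc]
  rw [← self_eq_neg, ← sum_neg_distrib]
  refine Finset.sum_nbij' (c • ·) (c⁻¹ • ·) ?_ ?_ ?_ ?_ ?_
  · intro α hα
    simpa [hc0] using hα
  · intro α hα
    simpa [hc0] using hα
  · intro α _
    simp [smul_smul, hc0]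
  · intro α _
    simp [smul_smul, hc0]
  · intro α hα
    have hα := (mem_filter.mp hα).2
    have hcα : ∀ e, (c • α) e ≠ 0 := fun e => mul_ne_zero hc0 (hα e)
    have hiff : ∀ W, sprime Mx W (c • α) ≠ 0 ↔ sprime Mx W α ≠ 0 := fun W => by
      simp [sprime_smul, hc0]
    have hcard : (Wstar (c • α)).card = (Wstar α).card :=
      le_antisymm (hW_min _ hcα _ ((hiff _).mpr (hW_ne α hα)))
        (hW_min α hα _ ((hiff _).mp (hW_ne _ hcα)))
    rw [card_compl (Wstar (c • α)), hcard, ← card_compl]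
    split_ifs with ho
    · rw [sum_addChar_eq_sprime hF hψ Mx α _ (hW_ne α hα) (hW_min α hα),
        sum_addChar_eq_sprime hF hψ Mx (c • α) (Wstar α) ((hiff _).mpr (hW_ne α hα))
          fun W hW => hW_min α hα W ((hiff W).mp hW),
        sprime_smul, map_mul, map_pow, heta, ho.neg_one_pow]
      ring
    · simp

end Summands

end

/-- **Theorem 4 of the paper.**  Let `𝙼` be a matrix over `𝔽_q` (odd `q = p^d`)
with rows `V`, columns `E` and rank `|V|`.  For everywhere-nonzero `α` let
`W*(α)` be a minimum-cardinality set of rows with `s'(𝙼/W*(α);α) ≠ 0`, and put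
`r*(α) = |V| − |W*(α)|`.  Then
`χ_{M✶}(q) = ∑_{S⊆E} (−1)^{|S|} q^{|E∖S|−rank 𝙼_{E∖S}}
           = ∑_α g(q,r*(α)) η(s'(𝙼/W*(α);α))`,
and each summand on the right does not depend on the choice of `W*(α)`. -/
theorem alpha_representation_matrix
    (V E : Type) [Fintype V] [Fintype E] [DecidableEq V] [DecidableEq E]
    (F : Type) [Field F] [Fintype F] [DecidableEq F]
    (p d : ℕ) (hp : p.Prime) (hpodd : Odd p) (hcard : Fintype.card F = p ^ d)
    (Mx : Matrix V E F) (hrank : Mx.rank = Fintype.card V)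
    (Wstar : (E → F) → Finset V)
    (hW_ne : ∀ α : E → F, (∀ e, α e ≠ 0) → sprime Mx (Wstar α) α ≠ 0)
    (hW_min : ∀ α : E → F, (∀ e, α e ≠ 0) →
      ∀ W : Finset V, sprime Mx W α ≠ 0 → (Wstar α).card ≤ W.card) :
    (∑ S : Finset E,
        (-1 : ℚ) ^ S.card * (Fintype.card F : ℚ) ^ (Sᶜ.card - colRank Mx Sᶜ)) =
      (∑ α ∈ Finset.univ.filter (fun α : E → F => ∀ e, α e ≠ 0),
        g F (Fintype.card V - (Wstar α).card) *
          ((quadraticChar F (sprime Mx (Wstar α) α) : ℤ) : ℚ))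
    ∧
    (∀ α : E → F, (∀ e, α e ≠ 0) →
      ∀ W₁ W₂ : Finset V,
        sprime Mx W₁ α ≠ 0 →
        (∀ W : Finset V, sprime Mx W α ≠ 0 → W₁.card ≤ W.card) →
        sprime Mx W₂ α ≠ 0 →
        (∀ W : Finset V, sprime Mx W α ≠ 0 → W₂.card ≤ W.card) →
        g F (Fintype.card V - W₁.card) *
            ((quadraticChar F (sprime Mx W₁ α) : ℤ) : ℚ) =
          g F (Fintype.card V - W₂.card) *
            ((quadraticChar F (sprime Mx W₂ α) : ℤ) : ℚ)) := by
  have hF : ringChar F ≠ 2 := fun h => by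
    have h2 := FiniteField.even_card_of_char_two h
    rw [hcard] at h2
    have := Nat.odd_iff.mp (hpodd.pow (n := d))
    omega
  let P := AddChar.FiniteField.primitiveChar F ℚ (by
    rw [ringChar.eq_zero]
    exact (CharP.ringChar_ne_zero_of_finite F).symm)
  have hψ := P.prim
  refine ⟨?_, fun α _ W₁ W₂ h₁ hmin₁ h₂ hmin₂ => ?_⟩
  · rw [sum_neg_one_pow_eq_card]
    have hq : (Fintype.card F : CyclotomicField P.n ℚ) ≠ 0 :=
      Nat.cast_ne_zero.mpr Fintype.card_ne_zero
    have hsum := sum_sum_addChar hψ Mx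
    rw [Finset.sum_congr rfl fun α hα => sum_addChar_eq_g_add hF hψ Mx α _
      (hW_ne α (Finset.mem_filter.mp hα).2) (hW_min α (Finset.mem_filter.mp hα).2),
      Finset.sum_add_distrib, sum_odd_eq_zero hF hψ Mx Wstar hW_ne hW_min, add_zero, ← Finset.mul_sum] at hsum
    have := mul_left_cancel₀ (pow_ne_zero _ hq) hsum
    rw [← Rat.cast_sum, ← Rat.cast_natCast] at this
    exact (Rat.cast_injective this).symm
  · rw [le_antisymm (hmin₁ W₂ h₂) (hmin₂ W₁ h₁),
      quadraticChar_sprime_eq hF hψ Mx α W₁ W₂ h₁ hmin₁ h₂ hmin₂]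

end AlphaRepr
end

section
/- Let M be a matroid on a finite ground set E with rank function r, and let α : E → 𝔽_q be nowhere zero. If A ⊆ E has maximum cardinality among subsets A' of E with s(M|A';α) ≠ 0, then r(A) = r(E). -/
/-!
STATEMENT 4: if `A` has maximum cardinality among subsets `A'` with
`s(M|A';α) ≠ 0` (for everywhere-nonzero `α`), then `r(A) = r(E)`
(Lemma 1 of the paper).
-/

namespace AlphaRepr

/-- A matroid on a finite ground set `E`, given by its rank function. -/
structure Matroid (E : Type) [Fintype E] [DecidableEq E] where
  r : Finset E → ℕ
  r_le_card : ∀ A : Finset E, r A ≤ A.card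
  r_mono : ∀ ⦃A B : Finset E⦄, A ⊆ B → r A ≤ r B
  r_submod : ∀ A B : Finset E, r (A ∪ B) + r (A ∩ B) ≤ r A + r B

variable {E : Type} [Fintype E] [DecidableEq E]

/-- The bases of the restriction `M|A`: maximal independent subsets of `A`. -/
def restrBases (M : Matroid E) (A : Finset E) : Finset (Finset E) :=
  A.powerset.filter fun B => M.r B = B.card ∧ M.r B = M.r A

/-- `s(M|A;α) = ∑_{B base of M|A} ∏_{e ∈ B} α_e`. -/
def sRestr {F : Type} [Field F] (M : Matroid E) (A : Finset E) (α : E → F) : F :=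
  ∑ B ∈ restrBases M A, ∏ e ∈ B, α e

theorem Matroid.r_insert_le (M : Matroid E) (A : Finset E) (e : E) :
    M.r (insert e A) ≤ M.r A + 1 := by
  have h := M.r_submod A {e}
  have h' := M.r_le_card {e}
  rw [Finset.union_comm, ← Finset.insert_eq] at h
  rw [Finset.card_singleton] at h'
  omega

/-- A set which no single element extends in rank has full rank. -/
theorem Matroid.r_eq_r_univ_of_forall_insert (M : Matroid E) (A : Finset E)
    (h : ∀ e, M.r (insert e A) = M.r A) : M.r A = M.r Finset.univ := by
  have key : ∀ S : Finset E, M.r (A ∪ S) = M.r A := by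
    intro S
    induction S using Finset.induction_on with
    | empty => simp
    | insert e S _ ih =>
      have h₁ := M.r_submod (insert e A) (A ∪ S)
      have h₂ : insert e A ∪ (A ∪ S) = A ∪ insert e S := by
        ext x; simp only [Finset.mem_union, Finset.mem_insert]; tauto
      have h₃ : M.r A ≤ M.r (insert e A ∩ (A ∪ S)) :=
        M.r_mono (Finset.subset_inter (Finset.subset_insert _ _) Finset.subset_union_left)
      have h₄ : M.r A ≤ M.r (A ∪ insert e S) := M.r_mono Finset.subset_union_left
      rw [h₂, h e, ih] at h₁
      omega
  have hu := key Finset.univ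
  rw [Finset.union_eq_right.2 (Finset.subset_univ A)] at hu
  exact hu.symm

theorem mem_restrBases {M : Matroid E} {A B : Finset E} :
    B ∈ restrBases M A ↔ B ⊆ A ∧ M.r B = B.card ∧ M.r B = M.r A := by
  simp [restrBases]

/-- If `e` is a coloop of `M|(A ∪ e)`, the bases of `M|(A ∪ e)` are the sets `B ∪ e`
with `B` a basis of `M|A`. -/
theorem restrBases_insert (M : Matroid E) {A : Finset E} {e : E} (he : e ∉ A)
    (hr : M.r (insert e A) = M.r A + 1) :
    restrBases M (insert e A) = (restrBases M A).image (insert e) := by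
  ext B
  simp only [Finset.mem_image, mem_restrBases]
  constructor
  · rintro ⟨hBA, hB, hBr⟩
    have heB : e ∈ B := by
      by_contra heB
      have := M.r_mono ((Finset.subset_insert_iff_of_notMem heB).1 hBA)
      omega
    have h₁ := M.r_insert_le (B.erase e) e
    have h₂ := M.r_le_card (B.erase e)
    have h₃ := Finset.card_erase_add_one heB
    rw [Finset.insert_erase heB] at h₁
    exact ⟨B.erase e, ⟨Finset.subset_insert_iff.1 hBA, by omega, by omega⟩,
      Finset.insert_erase heB⟩
  · rintro ⟨B, ⟨hBA, hB, hBr⟩, rfl⟩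
    have h₁ := M.r_submod A (insert e B)
    have h₂ : A ∪ insert e B = insert e A := by
      rw [Finset.union_insert, Finset.union_eq_left.2 hBA]
    have h₃ : A ∩ insert e B = B := by
      rw [Finset.inter_insert_of_notMem he, Finset.inter_eq_right.2 hBA]
    have h₄ := M.r_insert_le B e
    have h₅ := Finset.card_insert_of_notMem (fun h => he (hBA h))
    rw [h₂, h₃] at h₁
    exact ⟨Finset.insert_subset_insert e hBA, by omega, by omega⟩

theorem sRestr_insert {F : Type} [Field F] (M : Matroid E) (α : E → F) {A : Finset E} {e : E}
    (he : e ∉ A) (hr : M.r (insert e A) = M.r A + 1) :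
    sRestr M (insert e A) α = α e * sRestr M A α := by
  have hmem : ∀ B ∈ restrBases M A, e ∉ B := fun B hB h => he ((mem_restrBases.1 hB).1 h)
  rw [sRestr, sRestr, restrBases_insert M he hr, Finset.sum_image, Finset.mul_sum]
  · exact Finset.sum_congr rfl fun B hB => Finset.prod_insert (hmem B hB)
  · intro B hB C hC h
    rw [← Finset.erase_insert (hmem B hB), ← Finset.erase_insert (hmem C hC)]
    exact congrArg (fun S => S.erase e) h

/-- **Lemma 1 of the paper.** -/
theorem rank_of_max_cardinality_support
    (E : Type) [Fintype E] [DecidableEq E]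
    (F : Type) [Field F] [Fintype F]
    (M : Matroid E) (α : E → F) (hα : ∀ e, α e ≠ 0)
    (A : Finset E)
    (hA_ne : sRestr M A α ≠ 0)
    (hA_max : ∀ A' : Finset E, sRestr M A' α ≠ 0 → A'.card ≤ A.card) :
    M.r A = M.r Finset.univ := by
  refine M.r_eq_r_univ_of_forall_insert A fun e => ?_
  by_contra hne
  have he : e ∉ A := fun h => hne (by rw [Finset.insert_eq_of_mem h])
  have hr : M.r (insert e A) = M.r A + 1 := by
    have h₁ := M.r_insert_le A e
    have h₂ := M.r_mono (Finset.subset_insert e A)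
    omega
  have hs : sRestr M (insert e A) α ≠ 0 := by
    rw [sRestr_insert M α he hr]
    exact mul_ne_zero (hα e) hA_ne
  have hcard := hA_max _ hs
  rw [Finset.card_insert_of_notMem he] at hcard
  omega

end AlphaRepr
end
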